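/- arXiv:2006.15842 — 3 statements merged into one kernel-verified Lean document; each statement's English description precedes it below -/
import Mathlib

section
/- Let θ be an irrational real number and let N ≥ 1 be an integer. Then the gap set G(θ, N) has cardinality either two or three, and if it has cardinality three, then the largest of the three elements equals the sum of the other two. -/
/-- The points `0, {θ}, {2θ}, …, {Nθ}, 1` used in the three-gap theorem. -/
def gapPoints (θ : ℝ) (N : ℕ) : Set ℝ :=
  insert 1 {x : ℝ | ∃ k : ℕ, k ≤ N ∧ x = Int.fract (k * θ)}

/-- The gap set `G(θ, N)`: the set of differences between consecutive points among
`0, {θ}, {2θ}, …, {Nθ}, 1` sorted in ascending order. -/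
def gapSet (θ : ℝ) (N : ℕ) : Set ℝ :=
  {d : ℝ | ∃ a ∈ gapPoints θ N, ∃ b ∈ gapPoints θ N,
    a < b ∧ (∀ c ∈ gapPoints θ N, ¬(a < c ∧ c < b)) ∧ d = b - a}

/-- An orbit of `0` under an irrational rotation: an injective sequence in `[0, 1)` that starts at `0` and is additive modulo
`1`. -/
structure IsRotationOrbit (f : ℕ → ℝ) : Prop where
  zero : f 0 = 0
  nonneg : ∀ k, 0 ≤ f k
  lt_one : ∀ k, f k < 1
  injective : Function.Injective f
  add : ∀ i j, f (i + j) = f i + f j ∨ f (i + j) = f i + f j - 1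

theorem isRotationOrbit_fract {θ : ℝ} (hθ : Irrational θ) :
    IsRotationOrbit fun k : ℕ => Int.fract (k * θ) where
  zero := by simp
  nonneg k := Int.fract_nonneg _
  lt_one k := Int.fract_lt_one _
  injective i j h := by
    obtain ⟨z, hz⟩ := Int.fract_eq_fract.1 h
    by_contra hij
    have hne : ((i : ℤ) - j : ℤ) ≠ 0 := by omega
    refine (hθ.intCast_mul hne).ne_int z ?_
    push_cast
    linarith
  add i j := by
    obtain ⟨z, hz⟩ := Int.fract_add (i * θ) (j * θ)
    have h0 := Int.fract_nonneg (i * θ + j * θ)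
    have h1 := Int.fract_lt_one (i * θ + j * θ)
    have h2 := Int.fract_nonneg (i * θ)
    have h3 := Int.fract_lt_one (i * θ)
    have h4 := Int.fract_nonneg (j * θ)
    have h5 := Int.fract_lt_one (j * θ)
    have hlo : (-2 : ℝ) < z := by linarith
    have hhi : (z : ℝ) < 1 := by linarith
    have hlo' : -2 < z := by exact_mod_cast hlo
    have hhi' : z < 1 := by exact_mod_cast hhi
    simp only [Nat.cast_add, add_mul]
    obtain rfl | rfl : z = 0 ∨ z = -1 := by omega
    · left; push_cast at hz; linarith
    · right; push_cast at hz; linarith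

namespace IsRotationOrbit

variable {f : ℕ → ℝ} {N p q : ℕ}

theorem pos (hf : IsRotationOrbit f) {k : ℕ} (hk : 1 ≤ k) : 0 < f k := by
  refine (hf.nonneg k).lt_of_ne fun h => ?_
  have := hf.injective (hf.zero.trans h)
  omega

/-- The right neighbour of `f k` when `k + p ≤ N`. -/
theorem next_add (hf : IsRotationOrbit f) (hp : 1 ≤ p)
    (hmin : ∀ m, 1 ≤ m → m ≤ N → f p ≤ f m) {k : ℕ} (hk : k + p ≤ N) :
    f (k + p) = f k + f p ∧ ∀ j ≤ N, f k < f j → f k + f p ≤ f j := by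
  refine ⟨?_, fun j hj hkj => ?_⟩
  · rcases hf.add k p with h | h
    · exact h
    · linarith [hmin (k + p) (by omega) hk, hf.lt_one k]
  · rcases lt_trichotomy k j with h | rfl | h
    · obtain ⟨m, rfl⟩ := Nat.exists_eq_add_of_le h.le
      rcases hf.add k m with h' | h'
      · linarith [hmin m (by omega) (by omega)]
      · linarith [hf.lt_one m]
    · exact absurd hkj (lt_irrefl _)
    · obtain ⟨m, rfl⟩ := Nat.exists_eq_add_of_le h.le
      have hmp := hmin (m + p) (by omega) (by omega)
      rcases hf.add j m with h' | h'
      · linarith [hf.nonneg m]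
      · rcases hf.add m p with h'' | h''
        · linarith [hf.lt_one (m + p)]
        · linarith [hf.lt_one m]

/-- The right neighbour of `f (k + q)` when `k + q ≤ N`. -/
theorem next_sub (hf : IsRotationOrbit f) (hq : 1 ≤ q)
    (hmax : ∀ m, 1 ≤ m → m ≤ N → f m ≤ f q) {k : ℕ} (hk : k + q ≤ N) :
    (f (k + q) + (1 - f q) = if k = 0 then 1 else f k) ∧
      ∀ j ≤ N, f (k + q) < f j → f (k + q) + (1 - f q) ≤ f j := by
  refine ⟨?_, fun j hj hkj => ?_⟩
  · split_ifs with h0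
    · subst h0; simp
    · rcases hf.add k q with h | h
      · linarith [hmax (k + q) (by omega) hk, hf.pos (show 1 ≤ k by omega)]
      · linarith
  · rcases lt_trichotomy (k + q) j with h | rfl | h
    · obtain ⟨m, rfl⟩ := Nat.exists_eq_add_of_le h.le
      have hmq := hmax (m + q) (by omega) (by omega)
      have hm := hf.pos (show 1 ≤ m by omega)
      rcases hf.add (k + q) m with h' | h'
      · rcases hf.add m q with h'' | h''
        · linarith
        · linarith [hf.nonneg (m + q)]
      · linarith [hf.lt_one m]
    · exact absurd hkj (lt_irrefl _)
    · obtain ⟨m, hm⟩ := Nat.exists_eq_add_of_le h.le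
      have hmq := hmax m (by omega) (by omega)
      rw [hm] at hkj ⊢
      rcases hf.add j m with h' | h'
      · linarith [hf.nonneg m]
      · linarith

/-- The right neighbour of `f k` when `N < k + p` and `k < q`. -/
theorem next_add_sub (hf : IsRotationOrbit f) (hpN : p ≤ N) (hqN : q ≤ N)
    (hmin : ∀ m, 1 ≤ m → m ≤ N → f p ≤ f m)
    (hmax : ∀ m, 1 ≤ m → m ≤ N → f m ≤ f q) {k : ℕ} (hk : N < k + p) (hkq : k < q) :
    f (k + p - q) = f k + (f p + (1 - f q)) ∧
      ∀ j ≤ N, f k < f j → f k + (f p + (1 - f q)) ≤ f j := by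
  have hpq := hmin q (by omega) hqN
  refine ⟨?_, fun j hj hkj => ?_⟩
  · obtain ⟨t, ht⟩ : ∃ t, k + p = t + q := ⟨k + p - q, by omega⟩
    rw [ht, Nat.add_sub_cancel]
    have hpt := hmin t (by omega) (by omega)
    have hlt : f k < f q := by
      rcases Nat.eq_zero_or_pos k with rfl | h
      · rw [hf.zero]; exact hf.pos hkq
      · exact (hmax k h (by omega)).lt_of_ne fun h => hkq.ne (hf.injective h)
    have h1 := hf.add k p
    have h2 := hf.add t q
    rw [ht] at h1
    have := hf.lt_one t
    have := hf.nonneg k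
    have := hf.lt_one q
    have := hf.pos (show 1 ≤ p by omega)
    rcases h1 with h1 | h1 <;> rcases h2 with h2 | h2 <;> linarith
  · rcases lt_trichotomy k j with h | rfl | h
    · obtain ⟨m, rfl⟩ := Nat.exists_eq_add_of_le h.le
      obtain ⟨n, rfl⟩ := Nat.exists_eq_add_of_le (show m ≤ p by omega)
      have hpm := hmin m (by omega) (by omega)
      have hnq := hmax n (by omega) (by omega)
      have := hf.pos (show 1 ≤ n by omega)
      have := hf.lt_one m
      rcases hf.add k m with h1 | h1 <;> rcases hf.add m n with h2 | h2 <;> linarith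
    · exact absurd hkj (lt_irrefl _)
    · obtain ⟨m, rfl⟩ := Nat.exists_eq_add_of_le h.le
      obtain ⟨n, rfl⟩ := Nat.exists_eq_add_of_le (show m ≤ q by omega)
      have hmq := hmax m (by omega) (by omega)
      have hpn := hmin n (by omega) (by omega)
      have := hf.nonneg m
      have := hf.lt_one n
      rcases hf.add j m with h1 | h1 <;> rcases hf.add m n with h2 | h2 <;> linarith

end IsRotationOrbit

/-- The gap set consists of the smallest point `x`, the distance `y` from the largest point to `1`,
and possibly `x + y`. -/
theorem exists_mem_gapSet_subset {θ : ℝ} (hθ : Irrational θ) {N : ℕ} (hN : 1 ≤ N) :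
    ∃ x y : ℝ, 0 < x ∧ 0 < y ∧ x ≠ y ∧ x ∈ gapSet θ N ∧ y ∈ gapSet θ N ∧
      gapSet θ N ⊆ {x, y, x + y} := by
  have hf := isRotationOrbit_fract hθ
  set f : ℕ → ℝ := fun k : ℕ => Int.fract (k * θ)
  have hpts : ∀ c, c ∈ gapPoints θ N ↔ c = 1 ∨ ∃ k ≤ N, c = f k := fun c => Iff.rfl
  have hmem : ∀ k ≤ N, f k ∈ gapPoints θ N := fun k hk => (hpts _).2 (Or.inr ⟨k, hk, rfl⟩)
  have hone : (1 : ℝ) ∈ gapPoints θ N := (hpts _).2 (Or.inl rfl)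
  have hne : (Finset.Icc 1 N).Nonempty := ⟨1, by simp [hN]⟩
  obtain ⟨p, hp, hmin'⟩ := Finset.exists_min_image (Finset.Icc 1 N) f hne
  obtain ⟨q, hq, hmax'⟩ := Finset.exists_max_image (Finset.Icc 1 N) f hne
  rw [Finset.mem_Icc] at hp hq
  obtain ⟨hp1, hpN⟩ := hp
  obtain ⟨hq1, hqN⟩ := hq
  have hmin : ∀ m, 1 ≤ m → m ≤ N → f p ≤ f m := fun m h1 h2 =>
    hmin' m (Finset.mem_Icc.2 ⟨h1, h2⟩)
  have hmax : ∀ m, 1 ≤ m → m ≤ N → f m ≤ f q := fun m h1 h2 =>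
    hmax' m (Finset.mem_Icc.2 ⟨h1, h2⟩)
  have hsub : ∀ k, k + q ≤ N → f (k + q) + (1 - f q) ∈ gapPoints θ N := fun k hk => by
    rw [(hf.next_sub hq1 hmax hk).1]
    split_ifs
    · exact hone
    · exact hmem k (by omega)
  have hle : ∀ c ∈ gapPoints θ N, c ≤ 1 := fun c hc => by
    rcases (hpts c).1 hc with rfl | ⟨k, -, rfl⟩
    · exact le_rfl
    · exact (hf.lt_one k).le
  have hbetween : ∀ k d, f k + d ∈ gapPoints θ N → (∀ j ≤ N, f k < f j → f k + d ≤ f j) →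
      ∀ c ∈ gapPoints θ N, ¬(f k < c ∧ c < f k + d) := by
    rintro k d hd hj c hc ⟨h1, h2⟩
    rcases (hpts c).1 hc with rfl | ⟨j, hjN, rfl⟩
    · exact (hle _ hd).not_gt h2
    · exact (hj j hjN h1).not_gt h2
  have hx : 0 < f p := hf.pos hp1
  have hy : 0 < 1 - f q := sub_pos.2 (hf.lt_one q)
  have hgap : ∀ k ≤ N, ∀ d, 0 < d → f k + d ∈ gapPoints θ N →
      (∀ j ≤ N, f k < f j → f k + d ≤ f j) → d ∈ gapSet θ N := fun k hk d hd hkd hj =>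
    ⟨f k, hmem k hk, f k + d, hkd, by linarith, hbetween k d hkd hj, by ring⟩
  have huniq : ∀ k b d, b ∈ gapPoints θ N → f k < b →
      (∀ c ∈ gapPoints θ N, ¬(f k < c ∧ c < b)) → 0 < d → f k + d ∈ gapPoints θ N →
      (∀ j ≤ N, f k < f j → f k + d ≤ f j) → b - f k = d := by
    intro k b d hb hkb hno hd hkd hj
    have h1 := hbetween k d hkd hj b hb
    have h2 := hno _ hkd
    rcases lt_trichotomy b (f k + d) with h | h | h
    · exact absurd ⟨hkb, h⟩ h1
    · linarith
    · exact absurd ⟨by linarith, h⟩ h2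
  refine ⟨f p, 1 - f q, hx, hy, fun hxy => ?_, ?_, ?_, ?_⟩
  · have : f (p + q) = f 0 := by
      rw [hf.zero]
      rcases hf.add p q with h | h
      · linarith [hf.lt_one (p + q)]
      · linarith
    have := hf.injective this
    omega
  · have h := hf.next_add hp1 hmin (k := 0) (by omega)
    exact hgap 0 (by omega) _ hx (h.1 ▸ hmem _ (by omega)) h.2
  · have h := hf.next_sub hq1 hmax (k := 0) (by omega)
    exact hgap (0 + q) (by omega) _ hy (hsub 0 (by omega)) h.2
  · rintro _ ⟨a, ha, b, hb, hab, hno, rfl⟩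
    rcases (hpts a).1 ha with rfl | ⟨k, hk, rfl⟩
    · exact absurd hab (hle b hb).not_gt
    rcases le_or_gt (k + p) N with hkp | hkp
    · have h := hf.next_add hp1 hmin hkp
      exact Or.inl (huniq k b _ hb hab hno hx (h.1 ▸ hmem _ hkp) h.2)
    rcases le_or_gt q k with hqk | hqk
    · obtain ⟨t, rfl⟩ := Nat.exists_eq_add_of_le' hqk
      have h := hf.next_sub hq1 hmax hk
      exact Or.inr (Or.inl (huniq _ b _ hb hab hno hy (hsub t hk) h.2))
    · have h := hf.next_add_sub hpN hqN hmin hmax hkp hqk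
      exact Or.inr (Or.inr (huniq k b _ hb hab hno (by linarith)
        (h.1 ▸ hmem _ (by omega)) h.2))

/-- **The three-gap theorem.**  For irrational `θ` and `N ≥ 1`, the gap set `G(θ, N)`
has cardinality two or three, and if it has cardinality three, the largest of the three
elements is the sum of the other two. -/
theorem three_gap_theorem (θ : ℝ) (hθ : Irrational θ) (N : ℕ) (hN : 1 ≤ N) :
    ((gapSet θ N).ncard = 2 ∨ (gapSet θ N).ncard = 3) ∧
    ((gapSet θ N).ncard = 3 →
      ∃ g₁ g₂ g₃ : ℝ, g₁ < g₂ ∧ g₂ < g₃ ∧ gapSet θ N = {g₁, g₂, g₃} ∧ g₃ = g₁ + g₂) := by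
  obtain ⟨x, y, hx, hy, hxy, hxG, hyG, hG⟩ := exists_mem_gapSet_subset hθ hN
  by_cases hs : x + y ∈ gapSet θ N
  · have heq : gapSet θ N = {x, y, x + y} := hG.antisymm (by
      rintro z (rfl | rfl | rfl) <;> assumption)
    refine ⟨Or.inr (Set.ncard_eq_three.2 ⟨x, y, x + y, hxy, by simpa using hy.ne',
      by simpa using hx.ne', heq⟩), fun _ => ?_⟩
    rcases hxy.lt_or_gt with h | h
    · exact ⟨x, y, x + y, h, by linarith, heq, rfl⟩
    · exact ⟨y, x, x + y, h, by linarith, by rw [heq, Set.insert_comm], add_comm x y⟩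
  · have heq : gapSet θ N = {x, y} := Set.Subset.antisymm (fun z hz => by
      rcases hG hz with rfl | rfl | rfl
      · exact Or.inl rfl
      · exact Or.inr rfl
      · exact absurd hz hs) (by rintro z (rfl | rfl) <;> assumption)
    have hcard : (gapSet θ N).ncard = 2 := by rw [heq, Set.ncard_pair hxy]
    exact ⟨Or.inl hcard, fun h => by omega⟩
end

section
/- Let θ be an irrational real number with 0 < θ < 1 whose continued fraction partial quotients a_i (i ≥ 1) are all at most B, and let β be a real number with 0 ≤ β < 1. Then for every integer N ≥ 1 there exist integers p, q with 0 ≤ p ≤ (B+2)N² and |q| ≤ (B+2)N² such that |pθ − β − q| ≤ 1/N. -/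
/-- `θ` has all partial quotients `a_i` (for `i ≥ 1`) of its simple continued fraction
expansion bounded by `B`.  (Index `i` of `partDens` corresponds to `a_{i+1}`.) -/
def PartQuotBounded (θ : ℝ) (B : ℕ) : Prop :=
  ∀ i : ℕ, ∀ a ∈ ((GenContFract.of θ).partDens.get? i), a ≤ (B : ℝ)

open GenContFract in
/-- The continued fraction of an irrational number does not terminate. -/
theorem Irrational.not_terminatedAt_of {θ : ℝ} (hθ : Irrational θ) (n : ℕ) :
    ¬(GenContFract.of θ).TerminatedAt n := fun h ↦ by
  obtain ⟨q, hq⟩ := (terminates_iff_rat θ).1 ⟨n, h⟩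
  exact hθ ⟨q, hq.symm⟩

open GenContFract in
/-- The continuants of the continued fraction of an irrational number are integers. -/
theorem Irrational.exists_int_contsAux_of {θ : ℝ} (hθ : Irrational θ) (n : ℕ) :
    ∃ P Q : ℤ, (GenContFract.of θ).contsAux n = ⟨(P : ℝ), (Q : ℝ)⟩ := by
  induction n using Nat.twoStepInduction with
  | zero => exact ⟨1, 0, by simp⟩
  | one => exact ⟨⌊θ⌋, 1, by simp⟩
  | more n ih₀ ih₁ =>
    obtain ⟨P₀, Q₀, h₀⟩ := ih₀
    obtain ⟨P₁, Q₁, h₁⟩ := ih₁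
    obtain ⟨gp, hgp⟩ := Option.ne_none_iff_exists'.1 (hθ.not_terminatedAt_of n)
    obtain ⟨ha, z, hz⟩ := of_partNum_eq_one_and_exists_int_partDen_eq hgp
    refine ⟨z * P₁ + P₀, z * Q₁ + Q₀, ?_⟩
    rw [contsAux_recurrence hgp h₀ h₁, ha, hz]
    push_cast
    simp only [one_mul]

/-- If `P / Q` is a reduced fraction with `|θ - P / Q| ≤ 1 / Q²`, then every real `β` is within
`1 / Q` of some `p θ - q` with `0 ≤ p < Q`. -/
theorem exists_abs_mul_sub_sub_le_of_isCoprime {θ : ℝ} {P Q : ℤ} (hQ : 0 < Q)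
    (hPQ : IsCoprime P Q) (h : |θ - P / Q| ≤ 1 / (Q : ℝ) ^ 2) (β : ℝ) :
    ∃ p q : ℤ, 0 ≤ p ∧ p < Q ∧ |(p : ℝ) * θ - β - q| ≤ 1 / Q := by
  obtain ⟨u, v, huv⟩ := hPQ
  have hQ' : (0 : ℝ) < Q := by exact_mod_cast hQ
  have residue (k : ℤ) : ∃ p q : ℤ, 0 ≤ p ∧ p < Q ∧ p * P - q * Q = k := by
    refine ⟨(u * k) % Q, -(v * k + (u * k) / Q * P), Int.emod_nonneg _ hQ.ne',
      Int.emod_lt_of_pos _ hQ, ?_⟩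
    rw [Int.emod_def]
    linear_combination k * huv
  set ε := (Q : ℝ) * (Q * θ - P) with hε
  have hε1 : |ε| ≤ 1 := by
    have : ε = (Q : ℝ) ^ 2 * (θ - P / Q) := by rw [hε]; field_simp
    rw [this, abs_mul, abs_of_pos (by positivity)]
    rwa [le_div_iff₀ (by positivity), mul_comm] at h
  obtain ⟨k, hk⟩ : ∃ k : ℤ, ∀ t : ℝ, 0 ≤ t → t ≤ 1 → |k - β * Q + t * ε| ≤ 1 := by
    rw [abs_le] at hε1
    rcases le_total 0 ε with h0 | h0
    · refine ⟨⌊β * Q⌋, fun t ht0 ht1 ↦ abs_le.2 ⟨?_, ?_⟩⟩ <;>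
        nlinarith [Int.floor_le (β * Q), Int.lt_floor_add_one (β * Q), mul_nonneg ht0 h0]
    · refine ⟨⌈β * Q⌉, fun t ht0 ht1 ↦ abs_le.2 ⟨?_, ?_⟩⟩ <;>
        nlinarith [Int.le_ceil (β * Q), Int.ceil_lt_add_one (β * Q),
          mul_nonneg ht0 (neg_nonneg.2 h0)]
  obtain ⟨p, q, hp0, hpQ, hpq⟩ := residue k
  refine ⟨p, q, hp0, hpQ, ?_⟩
  have hp0' : (0 : ℝ) ≤ p := by exact_mod_cast hp0
  have hpQ' : (p : ℝ) ≤ Q := by exact_mod_cast hpQ.le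
  have hpq' : (p : ℝ) * P - q * Q = k := by exact_mod_cast hpq
  have key := hk (p / Q) (by positivity) ((div_le_one hQ').2 hpQ')
  have : (k : ℝ) - β * Q + p / Q * ε = (p * θ - β - q) * Q := by
    rw [hε, ← hpq']
    field_simp
    ring
  rwa [this, abs_mul, abs_of_pos hQ', ← le_div_iff₀ hQ'] at key

open GenContFract in
/-- If the partial quotients of `θ` are bounded by `B`, then some convergent of `θ` has its
denominator between `N` and `(B + 1) N`. -/
theorem PartQuotBounded.exists_convergent {θ : ℝ} (hθ : Irrational θ) {B : ℕ}
    (hB : PartQuotBounded θ B) {N : ℕ} (hN : 1 ≤ N) :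
    ∃ P Q : ℤ, (N : ℤ) ≤ Q ∧ Q ≤ (B + 1) * N ∧ IsCoprime P Q ∧
      |θ - P / Q| ≤ 1 / (Q : ℝ) ^ 2 := by
  have hN' : (1 : ℝ) ≤ N := by exact_mod_cast hN
  have hex : ∃ n, (N : ℝ) ≤ ((GenContFract.of θ).contsAux n).b := by
    refine ⟨N + 5 + 1, le_trans ?_ <| succ_nth_fib_le_of_nth_den (n := N + 5) <|
      Or.inr (hθ.not_terminatedAt_of _)⟩
    have := Nat.le_fib_self (n := N + 5 + 1) (by omega)
    exact_mod_cast (by omega : N ≤ Nat.fib (N + 5 + 1))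
  classical
  obtain ⟨m, hm⟩ : ∃ m, Nat.find hex = m + 1 := by
    refine Nat.exists_eq_succ_of_ne_zero fun h0 ↦ ?_
    have := Nat.find_spec hex
    rw [h0, zeroth_contAux_eq_one_zero] at this
    linarith
  have hlow := Nat.find_spec hex
  have hmin (k : ℕ) (hk : k ≤ m) : ((GenContFract.of θ).contsAux k).b < N :=
    not_le.1 (Nat.find_min hex (by omega))
  rw [hm] at hlow
  have hupp : ((GenContFract.of θ).contsAux (m + 1)).b ≤ (B + 1) * N := by
    rcases m with _ | k
    · rw [first_contAux_eq_h_one]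
      nlinarith [(Nat.cast_nonneg B : (0 : ℝ) ≤ B)]
    · obtain ⟨gp, hgp⟩ := Option.ne_none_iff_exists'.1 (hθ.not_terminatedAt_of k)
      have hgB : gp.b ≤ B := hB k _ (partDen_eq_s_b hgp)
      rw [contsAux_recurrence hgp rfl rfl,
        (of_partNum_eq_one_and_exists_int_partDen_eq hgp).1]
      have h₀ := hmin k (by omega)
      have h₁ := hmin (k + 1) le_rfl
      have h₂ : 0 ≤ ((GenContFract.of θ).contsAux (k + 1)).b := zero_le_of_contsAux_b
      nlinarith [mul_le_mul hgB h₁.le h₂ (Nat.cast_nonneg B)]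
  have hdet := (SimpContFract.of θ).determinant (hθ.not_terminatedAt_of m)
  have happ := abs_sub_convs_le (hθ.not_terminatedAt_of m)
  have hmono := of_den_mono (v := θ) (n := m)
  obtain ⟨P, Q, hPQ⟩ := hθ.exists_int_contsAux_of (m + 1)
  obtain ⟨P', Q', hPQ'⟩ := hθ.exists_int_contsAux_of (m + 2)
  have hnum : (GenContFract.of θ).nums m = P := congrArg Pair.a hPQ
  have hden : (GenContFract.of θ).dens m = Q := congrArg Pair.b hPQ
  have hnum' : (GenContFract.of θ).nums (m + 1) = P' := congrArg Pair.a hPQ'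
  have hden' : (GenContFract.of θ).dens (m + 1) = Q' := congrArg Pair.b hPQ'
  change (GenContFract.of θ).nums m * (GenContFract.of θ).dens (m + 1) -
    (GenContFract.of θ).dens m * (GenContFract.of θ).nums (m + 1) = _ at hdet
  rw [hnum, hden, hnum', hden'] at hdet
  rw [conv_eq_num_div_den, hnum, hden, hden'] at happ
  rw [hden, hden'] at hmono
  rw [hPQ] at hlow hupp
  dsimp only at hlow hupp
  have hQ : (0 : ℝ) < Q := by linarith
  refine ⟨P, Q, by exact_mod_cast hlow, by exact_mod_cast hupp, ?_, happ.trans ?_⟩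
  · have hdet' : P * Q' - Q * P' = (-1) ^ (m + 1) := by exact_mod_cast hdet
    have hsq : ((-1 : ℤ) ^ (m + 1)) * (-1) ^ (m + 1) = 1 := by
      rw [← mul_pow]; simp
    exact ⟨(-1) ^ (m + 1) * Q', -((-1) ^ (m + 1) * P'), by
      linear_combination (-1) ^ (m + 1) * hdet' + hsq⟩
  · rw [sq]
    gcongr


/-- **Theorem 17 of Shallit (1996).**  If `θ ∈ (0,1)` is irrational with partial quotients
bounded by `B` and `0 ≤ β < 1`, then for all `N ≥ 1` there exist integers `p, q` with
`0 ≤ p ≤ (B+2)N²` and `|q| ≤ (B+2)N²` such that `|pθ - β - q| ≤ 1/N`. -/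
theorem kronecker_badly_approximable_old (θ : ℝ) (hθ : Irrational θ)
    (hθ0 : 0 < θ) (hθ1 : θ < 1) (B : ℕ) (hB : PartQuotBounded θ B)
    (β : ℝ) (hβ0 : 0 ≤ β) (hβ1 : β < 1) (N : ℕ) (hN : 1 ≤ N) :
    ∃ p q : ℤ, 0 ≤ p ∧ p ≤ ((B : ℤ) + 2) * (N : ℤ) ^ 2 ∧ |q| ≤ ((B : ℤ) + 2) * (N : ℤ) ^ 2 ∧
      |(p : ℝ) * θ - β - (q : ℝ)| ≤ 1 / (N : ℝ) := by
  obtain ⟨P, Q, hNQ, hQB, hPQ, happ⟩ := hB.exists_convergent hθ hN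
  have hN' : (1 : ℤ) ≤ N := by exact_mod_cast hN
  obtain ⟨p, q, hp0, hpQ, hpq⟩ :=
    exists_abs_mul_sub_sub_le_of_isCoprime (by omega : 0 < Q) hPQ happ β
  have hNpos : (1 : ℝ) ≤ N := by exact_mod_cast hN
  have hNQ' : (N : ℝ) ≤ Q := by exact_mod_cast hNQ
  have herr : |(p : ℝ) * θ - β - q| ≤ 1 / N := hpq.trans (by gcongr)
  have hQle : Q ≤ ((B : ℤ) + 2) * (N : ℤ) ^ 2 := by
    nlinarith [(Nat.cast_nonneg B : (0 : ℤ) ≤ B), mul_nonneg (Nat.cast_nonneg B : (0 : ℤ) ≤ B)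
      (mul_nonneg (by omega : (0 : ℤ) ≤ N) (sub_nonneg.2 hN'))]
  have hp0' : (0 : ℝ) ≤ p := by exact_mod_cast hp0
  have hN1 : 1 / (N : ℝ) ≤ 1 := (div_le_one (by linarith)).2 hNpos
  obtain ⟨hl, hu⟩ := abs_le.1 herr
  have hq_low : -2 < q := by
    have : (-2 : ℝ) < q := by nlinarith
    exact_mod_cast this
  have hq_upp : q ≤ p + 1 := by
    have : (q : ℝ) ≤ p + 1 := by nlinarith
    exact_mod_cast this
  exact ⟨p, q, hp0, by omega, abs_le.2 ⟨by omega, by omega⟩, herr⟩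
end

section
/- Let a be a positive integer and let B = 2a. Then f(B) = 1 + (a+1)²/(2·√(a²+2a)), where f(B) = sup over θ ∈ S_B and over positive integers N of N·H(θ, N). -/
/-- `H(θ, N)`, the largest gap in the gap set `G(θ, N)`. -/
noncomputable def maxGap (θ : ℝ) (N : ℕ) : ℝ := sSup (gapSet θ N)

/-- `S_B`: the set of irrational numbers in `(0,1)` with partial quotients bounded by `B`. -/
def SB (B : ℕ) : Set ℝ :=
  {θ : ℝ | Irrational θ ∧ θ ∈ Set.Ioo (0 : ℝ) 1 ∧ PartQuotBounded θ B}

/-- `f(B) = sup_{θ ∈ S_B} sup_{N ≥ 1} N · H(θ, N)`. -/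
noncomputable def badF (B : ℕ) : ℝ :=
  sSup {x : ℝ | ∃ θ ∈ SB B, ∃ N : ℕ, 1 ≤ N ∧ x = (N : ℝ) * maxGap θ N}

/-! ### Gaps between the points `{kθ}` -/

lemma fract_mem_gapPoints (θ : ℝ) {k N : ℕ} (hk : k ≤ N) :
    Int.fract (k * θ) ∈ gapPoints θ N :=
  Or.inr ⟨k, hk, rfl⟩

lemma mem_Icc_of_mem_gapPoints {θ : ℝ} {N : ℕ} {x : ℝ} (hx : x ∈ gapPoints θ N) :
    x ∈ Set.Icc (0 : ℝ) 1 := by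
  rcases hx with rfl | ⟨k, -, rfl⟩
  · simp
  · exact ⟨Int.fract_nonneg _, (Int.fract_lt_one _).le⟩

/-- If `j'θ` lies at distance `δ ∈ (0, ε]` to the right of `jθ` modulo one, then the gap starting
at `{jθ}` has length at most `ε`. -/
lemma gap_le_of_shift {θ : ℝ} {N j j' : ℕ} {b ε : ℝ} (l : ℤ) (hj' : j' ≤ N)
    (hb : b ∈ gapPoints θ N)
    (hgap : ∀ c ∈ gapPoints θ N, ¬(Int.fract (j * θ) < c ∧ c < b))
    (hpos : 0 < j' * θ - j * θ - l) (hle : j' * θ - j * θ - l ≤ ε) :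
    b - Int.fract (j * θ) ≤ ε := by
  by_contra! h
  have hb1 := (mem_Icc_of_mem_gapPoints hb).2
  have h0 := Int.fract_nonneg (j * θ)
  have hf : Int.fract (j' * θ) = Int.fract (j * θ) + (j' * θ - j * θ - l) := by
    rw [Int.fract_eq_iff]
    refine ⟨by linarith, by linarith, ⌊j * θ⌋ + l, ?_⟩
    rw [Int.fract]
    push_cast
    ring
  refine hgap _ (fract_mem_gapPoints θ hj') ⟨?_, ?_⟩ <;> rw [hf] <;> linarith

lemma gap_le_add {θ : ℝ} {N P Q : ℕ} {p p' : ℤ} (hP : P ≤ N) (hQ : Q ≤ N)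
    (h₁ : 0 < P * θ - p) (h₂ : 0 < p' - Q * θ) {d : ℝ} (hd : d ∈ gapSet θ N) :
    d ≤ (P * θ - p) + (p' - Q * θ) := by
  obtain ⟨x, hx, b, hb, hxb, hgap, rfl⟩ := hd
  rcases hx with rfl | ⟨j, hj, rfl⟩
  · exact absurd (mem_Icc_of_mem_gapPoints hb).2 (not_le.2 hxb)
  by_cases hjP : j + P ≤ N
  · refine gap_le_of_shift p hjP hb hgap ?_ ?_ <;> push_cast <;> linarith
  by_cases hjQ : Q ≤ j
  · obtain ⟨i, rfl⟩ := Nat.exists_eq_add_of_le hjQ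
    refine gap_le_of_shift (j' := i) (-p') (by omega) hb hgap ?_ ?_ <;> push_cast <;> linarith
  · obtain ⟨i, hi⟩ := Nat.exists_eq_add_of_le (show Q ≤ j + P by omega)
    have hi' : (j : ℝ) + P = Q + i := by exact_mod_cast hi
    have e : (i : ℝ) * θ = j * θ + P * θ - Q * θ := by
      rw [show (i : ℝ) = j + P - Q by linarith]; ring
    refine gap_le_of_shift (j' := i) (p - p') (by omega) hb hgap ?_ ?_ <;> push_cast <;> linarith

lemma maxGap_le_add {θ : ℝ} {N P Q : ℕ} {p p' : ℤ} (hP : P ≤ N) (hQ : Q ≤ N)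
    (h₁ : 0 < P * θ - p) (h₂ : 0 < p' - Q * θ) :
    maxGap θ N ≤ (P * θ - p) + (p' - Q * θ) :=
  Real.sSup_le (fun _ hd => gap_le_add hP hQ h₁ h₂ hd) (by linarith)

lemma bddAbove_gapSet (θ : ℝ) (N : ℕ) : BddAbove (gapSet θ N) := by
  refine ⟨1, ?_⟩
  rintro _ ⟨x, hx, b, hb, -, -, rfl⟩
  linarith [(mem_Icc_of_mem_gapPoints hx).1, (mem_Icc_of_mem_gapPoints hb).2]

/-- For a unimodular pair of one-sided approximations with denominators `P` and `Q`, the points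
`(Q - 1)θ` and `(P - 1)θ` are adjacent when `N = P + Q - 2`. -/
lemma add_le_maxGap {θ : ℝ} {P Q : ℕ} {p p' : ℤ}
    (h₁ : 0 < (P + 1 : ℕ) * θ - p) (h₂ : 0 < p' - (Q + 1 : ℕ) * θ)
    (hdet : (P + 1 : ℕ) * p' - (Q + 1 : ℕ) * p = 1) :
    ((P + 1 : ℕ) * θ - p) + (p' - (Q + 1 : ℕ) * θ) ≤ maxGap θ (P + Q) := by
  set d₁ := (P + 1 : ℕ) * θ - p with hd₁
  set d₂ := p' - (Q + 1 : ℕ) * θ with hd₂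
  have key : ∀ i : ℕ, i ≤ P + Q → ∀ l : ℤ,
      ¬(0 < i * θ - Q * θ - l ∧ i * θ - Q * θ - l < d₁ + d₂) := by
    rintro i hi l ⟨hl, hr⟩
    obtain ⟨x, hx⟩ : ∃ x : ℤ, x = ((i : ℤ) - Q) * p' - l * (Q + 1 : ℕ) := ⟨_, rfl⟩
    obtain ⟨y, hy⟩ : ∃ y : ℤ, y = l * (P + 1 : ℕ) - ((i : ℤ) - Q) * p := ⟨_, rfl⟩
    have hn : (i : ℤ) - Q = x * (P + 1 : ℕ) + y * (Q + 1 : ℕ) := by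
      rw [hx, hy]; linear_combination (-((i : ℤ) - Q)) * hdet
    have hll : l = x * p + y * p' := by
      rw [hx, hy]; linear_combination (-l) * hdet
    have hδ : i * θ - Q * θ - l = x * d₁ - y * d₂ := by
      have hn' : (i : ℝ) - Q = x * (P + 1 : ℕ) + y * (Q + 1 : ℕ) := by exact_mod_cast hn
      have hl' : (l : ℝ) = x * p + y * p' := by exact_mod_cast hll
      rw [hd₁, hd₂]
      linear_combination θ * hn' - hl'
    rw [hδ] at hl hr
    push_cast at hn
    rcases le_or_gt x 0 with hx0 | hx0 <;> rcases le_or_gt 0 y with hy0 | hy0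
    · have : (x : ℝ) ≤ 0 := by exact_mod_cast hx0
      have : (0 : ℝ) ≤ y := by exact_mod_cast hy0
      nlinarith
    · nlinarith
    · nlinarith
    · have : (1 : ℝ) ≤ x := by exact_mod_cast hx0
      have : (y : ℝ) ≤ -1 := by exact_mod_cast Int.le_sub_one_of_lt hy0
      nlinarith
  have hb : Int.fract (Q * θ) + (d₁ + d₂) ∈ gapPoints θ (P + Q) := by
    have hle : Int.fract (Q * θ) + (d₁ + d₂) ≤ 1 := by
      by_contra! h
      refine key 0 (Nat.zero_le _) (-⌊Q * θ⌋ - 1) ?_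
      have := Int.fract_lt_one (Q * θ)
      rw [Int.fract] at this h
      push_cast
      constructor <;> linarith
    rcases hle.eq_or_lt with h | h
    · exact Or.inl h
    · refine Or.inr ⟨P, by omega, ?_⟩
      symm
      rw [Int.fract_eq_iff]
      refine ⟨by linarith [Int.fract_nonneg (Q * θ)], h, ⌊Q * θ⌋ + p - p', ?_⟩
      rw [Int.fract, hd₁, hd₂]
      push_cast
      ring
  refine le_csSup (bddAbove_gapSet θ _)
    ⟨_, fract_mem_gapPoints θ (show Q ≤ P + Q by omega), _, hb, by linarith, ?_, by ring⟩
  rintro c hc ⟨hc₁, hc₂⟩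
  rcases hc with rfl | ⟨i, hi, rfl⟩
  · refine key 0 (Nat.zero_le _) (-⌊Q * θ⌋ - 1) ?_
    rw [Int.fract] at hc₁ hc₂
    push_cast
    constructor <;> linarith
  · refine key i hi (⌊i * θ⌋ - ⌊Q * θ⌋) ?_
    rw [Int.fract, Int.fract] at hc₁ hc₂
    push_cast
    constructor <;> linarith

/-! ### The Gauss map and convergents -/

/-- The orbit of `θ` under the Gauss map `x ↦ {1/x}`. -/
noncomputable def gaussOrbit (θ : ℝ) : ℕ → ℝ
  | 0 => θ
  | n + 1 => Int.fract (gaussOrbit θ n)⁻¹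

/-- The partial quotient `a_{n+1}` of `θ ∈ (0, 1)`. -/
noncomputable def partQuot (θ : ℝ) (n : ℕ) : ℕ := ⌊(gaussOrbit θ n)⁻¹⌋₊

/-- Denominators of convergents, starting with `q_{-1} = 0`, `q_0 = 1`. -/
noncomputable def convDen (θ : ℝ) : ℕ → ℕ
  | 0 => 0
  | 1 => 1
  | n + 2 => partQuot θ n * convDen θ (n + 1) + convDen θ n

/-- Numerators of convergents, starting with `p_{-1} = 1`, `p_0 = 0`. -/
noncomputable def convNum (θ : ℝ) : ℕ → ℤ
  | 0 => 1
  | 1 => 0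
  | n + 2 => partQuot θ n * convNum θ (n + 1) + convNum θ n

/-- The approximation errors `|q_{n-1} θ - p_{n-1}|`, as products along the Gauss orbit. -/
noncomputable def convErr (θ : ℝ) : ℕ → ℝ
  | 0 => 1
  | n + 1 => gaussOrbit θ n * convErr θ n

section GaussMap

variable {θ : ℝ}

lemma gaussOrbit_irrational_mem (hirr : Irrational θ) (hθ : θ ∈ Set.Ioo (0 : ℝ) 1) (n : ℕ) :
    Irrational (gaussOrbit θ n) ∧ gaussOrbit θ n ∈ Set.Ioo (0 : ℝ) 1 := by
  induction n with
  | zero => exact ⟨hirr, hθ⟩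
  | succ n ih =>
    have h : Irrational (Int.fract (gaussOrbit θ n)⁻¹) := by
      rw [Int.fract]
      exact ih.1.inv.sub_intCast _
    exact ⟨h, lt_of_le_of_ne (Int.fract_nonneg _) (Ne.symm h.ne_zero), Int.fract_lt_one _⟩

lemma inv_gaussOrbit (hirr : Irrational θ) (hθ : θ ∈ Set.Ioo (0 : ℝ) 1) (n : ℕ) :
    (gaussOrbit θ n)⁻¹ = partQuot θ n + gaussOrbit θ (n + 1) := by
  have h := (gaussOrbit_irrational_mem hirr hθ n).2.1
  rw [gaussOrbit, partQuot, natCast_floor_eq_intCast_floor (inv_nonneg.2 h.le),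
    Int.floor_add_fract]

lemma gaussOrbit_mul (hirr : Irrational θ) (hθ : θ ∈ Set.Ioo (0 : ℝ) 1) (n : ℕ) :
    gaussOrbit θ n * (partQuot θ n + gaussOrbit θ (n + 1)) = 1 := by
  rw [← inv_gaussOrbit hirr hθ]
  exact mul_inv_cancel₀ (gaussOrbit_irrational_mem hirr hθ n).2.1.ne'

lemma one_le_partQuot (hirr : Irrational θ) (hθ : θ ∈ Set.Ioo (0 : ℝ) 1) (n : ℕ) :
    1 ≤ partQuot θ n := by
  have h := (gaussOrbit_irrational_mem hirr hθ n).2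
  refine Nat.le_floor ?_
  rw [Nat.cast_one]
  exact (one_le_inv₀ h.1).2 h.2.le

lemma stream_eq_gaussOrbit (hirr : Irrational θ) (hθ : θ ∈ Set.Ioo (0 : ℝ) 1) (n : ℕ) :
    ∃ b : ℤ, GenContFract.IntFractPair.stream θ n = some ⟨b, gaussOrbit θ n⟩ := by
  induction n with
  | zero =>
    refine ⟨⌊θ⌋, ?_⟩
    rw [GenContFract.IntFractPair.stream_zero, GenContFract.IntFractPair.of, gaussOrbit,
      Int.fract_eq_self.2 ⟨hθ.1.le, hθ.2⟩]
  | succ n ih =>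
    obtain ⟨b, hb⟩ := ih
    exact ⟨_, GenContFract.IntFractPair.stream_succ_of_some hb
      (gaussOrbit_irrational_mem hirr hθ n).1.ne_zero⟩

lemma partDens_get?_eq (hirr : Irrational θ) (hθ : θ ∈ Set.Ioo (0 : ℝ) 1) (n : ℕ) :
    (GenContFract.of θ).partDens.get? n = some (partQuot θ n : ℝ) := by
  obtain ⟨b, hb⟩ := stream_eq_gaussOrbit hirr hθ n
  have h := (gaussOrbit_irrational_mem hirr hθ n)
  rw [GenContFract.partDen_eq_s_b
    (GenContFract.get?_of_eq_some_of_get?_intFractPair_stream_fr_ne_zero hb h.1.ne_zero)]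
  rw [partQuot, natCast_floor_eq_intCast_floor (inv_nonneg.2 h.2.1.le)]
  rfl

lemma partQuotBounded_iff (hirr : Irrational θ) (hθ : θ ∈ Set.Ioo (0 : ℝ) 1) (B : ℕ) :
    PartQuotBounded θ B ↔ ∀ n, partQuot θ n ≤ B := by
  simp [PartQuotBounded, partDens_get?_eq hirr hθ]

lemma convErr_pos (hirr : Irrational θ) (hθ : θ ∈ Set.Ioo (0 : ℝ) 1) (n : ℕ) :
    0 < convErr θ n := by
  induction n with
  | zero => exact one_pos
  | succ n ih => exact mul_pos (gaussOrbit_irrational_mem hirr hθ n).2.1 ih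

lemma convErr_eq_mul (hirr : Irrational θ) (hθ : θ ∈ Set.Ioo (0 : ℝ) 1) (n : ℕ) :
    convErr θ n = (partQuot θ n + gaussOrbit θ (n + 1)) * convErr θ (n + 1) := by
  rw [convErr.eq_2]
  linear_combination (-convErr θ n) * gaussOrbit_mul hirr hθ n

lemma convErr_add_two (hirr : Irrational θ) (hθ : θ ∈ Set.Ioo (0 : ℝ) 1) (n : ℕ) :
    convErr θ (n + 2) = convErr θ n - partQuot θ n * convErr θ (n + 1) := by
  rw [convErr_eq_mul hirr hθ n, convErr.eq_2 θ (n + 1)]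
  ring

lemma convErr_eq (hirr : Irrational θ) (hθ : θ ∈ Set.Ioo (0 : ℝ) 1) (n : ℕ) :
    convErr θ n = (-1) ^ (n + 1) * (convDen θ n * θ - convNum θ n) := by
  induction n using Nat.twoStepInduction with
  | zero => simp [convErr, convDen, convNum]
  | one => simp [convErr, convDen, convNum, gaussOrbit]
  | more n h₁ h₂ =>
    rw [convErr_add_two hirr hθ, h₁, h₂, convDen, convNum]
    push_cast
    ring

lemma convDen_det (θ : ℝ) (n : ℕ) :
    convDen θ (n + 1) * convNum θ n - convDen θ n * convNum θ (n + 1) = (-1) ^ n := by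
  induction n with
  | zero => simp [convDen, convNum]
  | succ n ih =>
    rw [convDen, convNum, pow_succ, ← ih]
    push_cast
    ring

lemma convDen_mul_convErr (hirr : Irrational θ) (hθ : θ ∈ Set.Ioo (0 : ℝ) 1) (n : ℕ) :
    convDen θ (n + 1) * convErr θ n + convDen θ n * convErr θ (n + 1) = 1 := by
  induction n with
  | zero => simp [convDen, convErr]
  | succ n ih =>
    rw [convErr_add_two hirr hθ, convDen]
    push_cast
    linear_combination ih

lemma convDen_pos (hirr : Irrational θ) (hθ : θ ∈ Set.Ioo (0 : ℝ) 1) (n : ℕ) :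
    0 < convDen θ (n + 1) := by
  induction n with
  | zero => simp [convDen]
  | succ n ih =>
    rw [convDen]
    have := Nat.mul_pos (one_le_partQuot hirr hθ n) ih
    omega

lemma convDen_add_le (hirr : Irrational θ) (hθ : θ ∈ Set.Ioo (0 : ℝ) 1) (n : ℕ) :
    convDen θ (n + 1) + convDen θ n ≤ convDen θ (n + 2) := by
  rw [convDen]
  have := Nat.mul_le_mul_right (convDen θ (n + 1)) (one_le_partQuot hirr hθ n)
  omega

lemma le_convDen (hirr : Irrational θ) (hθ : θ ∈ Set.Ioo (0 : ℝ) 1) (n : ℕ) :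
    n ≤ convDen θ (n + 1) := by
  induction n with
  | zero => simp
  | succ n ih =>
    rcases n with _ | n
    · exact convDen_pos hirr hθ 1
    · have h : convDen θ (n + 2) + convDen θ (n + 1) ≤ convDen θ (n + 3) :=
        convDen_add_le hirr hθ (n + 1)
      have := convDen_pos hirr hθ n
      change n + 2 ≤ convDen θ (n + 3)
      change n + 1 ≤ convDen θ (n + 2) at ih
      omega

lemma convDen_le_succ (hirr : Irrational θ) (hθ : θ ∈ Set.Ioo (0 : ℝ) 1) (n : ℕ) :
    convDen θ n ≤ convDen θ (n + 1) := by
  rcases n with _ | n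
  · simp [convDen]
  · exact (Nat.le_add_right _ _).trans (convDen_add_le hirr hθ n)

/-- The largest gap is at most the sum of the errors of a convergent and an intermediate
fraction. -/
lemma maxGap_le_convErr (hirr : Irrational θ) (hθ : θ ∈ Set.Ioo (0 : ℝ) 1) {n m N : ℕ}
    (hm : m < partQuot θ n) (hP : convDen θ (n + 1) ≤ N)
    (hQ : convDen θ n + m * convDen θ (n + 1) ≤ N) :
    maxGap θ N ≤ convErr θ n - m * convErr θ (n + 1) + convErr θ (n + 1) := by
  have h₁ := convErr_pos hirr hθ (n + 1)
  have h₂ : 0 < convErr θ n - m * convErr θ (n + 1) := by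
    rw [convErr_eq_mul hirr hθ n]
    have hx := (gaussOrbit_irrational_mem hirr hθ (n + 1)).2.1
    have hm' : (m : ℝ) + 1 ≤ partQuot θ n := by exact_mod_cast hm
    rw [← sub_mul]
    exact mul_pos (by linarith) h₁
  rcases n.even_or_odd with hn | hn
  · have e₁ : convErr θ (n + 1) = convDen θ (n + 1) * θ - convNum θ (n + 1) := by
      rw [convErr_eq hirr hθ, hn.add_one.add_one.neg_one_pow, one_mul]
    have e₂ : convErr θ n - m * convErr θ (n + 1) =
        ((convNum θ n + m * convNum θ (n + 1) : ℤ) : ℝ) -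
          ((convDen θ n + m * convDen θ (n + 1) : ℕ) : ℝ) * θ := by
      rw [e₁, convErr_eq hirr hθ n, hn.add_one.neg_one_pow]
      push_cast
      ring
    rw [e₂, add_comm, e₁]
    rw [e₁] at h₁
    rw [e₂] at h₂
    exact maxGap_le_add hP hQ h₁ h₂
  · have e₁ : convErr θ (n + 1) = convNum θ (n + 1) - convDen θ (n + 1) * θ := by
      rw [convErr_eq hirr hθ, hn.add_one.add_one.neg_one_pow]
      ring
    have e₂ : convErr θ n - m * convErr θ (n + 1) =
        ((convDen θ n + m * convDen θ (n + 1) : ℕ) : ℝ) * θ -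
        ((convNum θ n + m * convNum θ (n + 1) : ℤ) : ℝ) := by
      rw [e₁, convErr_eq hirr hθ n, hn.add_one.neg_one_pow]
      push_cast
      ring
    rw [e₂, e₁]
    rw [e₁] at h₁
    rw [e₂] at h₂
    exact maxGap_le_add hQ hP h₂ h₁

lemma exists_convDen_bracket (hirr : Irrational θ) (hθ : θ ∈ Set.Ioo (0 : ℝ) 1) {N : ℕ}
    (hN : 1 ≤ N) :
    ∃ n m : ℕ, m < partQuot θ n ∧ convDen θ (n + 1) ≤ N ∧
      convDen θ n + m * convDen θ (n + 1) ≤ N ∧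
      N + 1 ≤ convDen θ n + (m + 1) * convDen θ (n + 1) := by
  have hex : ∃ k, N < convDen θ (k + 1) := ⟨N + 1, le_convDen hirr hθ (N + 1)⟩
  classical
  obtain ⟨n, hn⟩ : ∃ n, Nat.find hex = n + 1 := by
    refine Nat.exists_eq_succ_of_ne_zero fun h => ?_
    have := Nat.find_spec hex
    rw [h] at this
    simp [convDen] at this
    omega
  have h₁ : convDen θ (n + 1) ≤ N := by
    have := Nat.find_min hex (m := n) (by omega)
    omega
  have h₂ : N < partQuot θ n * convDen θ (n + 1) + convDen θ n := by
    have := Nat.find_spec hex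
    rwa [hn, convDen] at this
  have h₃ := convDen_le_succ hirr hθ n
  have hpos := convDen_pos hirr hθ n
  refine ⟨n, (N - convDen θ n) / convDen θ (n + 1), ?_, h₁, ?_, ?_⟩
  · rw [Nat.div_lt_iff_lt_mul hpos]
    omega
  · have := Nat.div_mul_le_self (N - convDen θ n) (convDen θ (n + 1))
    omega
  · have := Nat.lt_div_mul_add (a := N - convDen θ n) hpos
    rw [add_mul, one_mul]
    omega

end GaussMap

/-! ### The extremal quadratic irrationals -/

/-- `√(a² + 2a)`. -/
noncomputable def evenRoot (a : ℕ) : ℝ := Real.sqrt ((a : ℝ) ^ 2 + 2 * a)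

/-- The number `[0; 1, 2a, 1, 2a, …] = √(a² + 2a) - a`. -/
noncomputable def evenMax (a : ℕ) : ℝ := evenRoot a - a

lemma evenRoot_sq (a : ℕ) : evenRoot a ^ 2 = (a : ℝ) ^ 2 + 2 * a :=
  Real.sq_sqrt (by positivity)

section Extremal

variable {a : ℕ}

lemma one_le_evenRoot (ha : 1 ≤ a) : 1 ≤ evenRoot a := by
  have : (1 : ℝ) ≤ a := by exact_mod_cast ha
  exact Real.one_le_sqrt.2 (by nlinarith)

lemma evenMax_mem (ha : 1 ≤ a) : evenMax a ∈ Set.Ioo (0 : ℝ) 1 := by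
  have : (1 : ℝ) ≤ a := by exact_mod_cast ha
  have h₁ := one_le_evenRoot ha
  have h₂ := evenRoot_sq a
  constructor <;> rw [evenMax] <;> nlinarith

lemma evenMax_quadratic (a : ℕ) : evenMax a ^ 2 + 2 * a * evenMax a = 2 * a := by
  rw [evenMax]
  linear_combination evenRoot_sq a

/-- `[0; 2a, 1, 2a, 1, …] = t / (2a)`, where `t = [0; 1, 2a, 1, 2a, …]`, satisfies `t(1 + u) = 1`
and `u(2a + t) = 1`. -/
lemma evenMax_relations (ha : 1 ≤ a) :
    evenMax a * (1 + evenMax a / (2 * a)) = 1 ∧ evenMax a / (2 * a) * (2 * a + evenMax a) = 1 := by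
  have : (1 : ℝ) ≤ a := by exact_mod_cast ha
  have h := evenMax_quadratic a
  constructor <;> field_simp <;> linarith

lemma irrational_evenMax (ha : 1 ≤ a) : Irrational (evenMax a) := by
  have h : Irrational (evenRoot a) := by
    rw [evenRoot, show (a : ℝ) ^ 2 + 2 * a = ((a ^ 2 + 2 * a : ℕ) : ℝ) by push_cast; ring,
      irrational_sqrt_natCast_iff]
    rintro ⟨k, hk⟩
    have h₁ : a < k := by nlinarith
    have h₂ : k < a + 1 := by nlinarith
    omega
  exact h.sub_natCast a

lemma gaussOrbit_le_evenMax {θ : ℝ} (ha : 1 ≤ a) (hirr : Irrational θ)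
    (hθ : θ ∈ Set.Ioo (0 : ℝ) 1) (hB : ∀ n, partQuot θ n ≤ 2 * a) (n : ℕ) :
    gaussOrbit θ n ≤ evenMax a := by
  have ha' : (1 : ℝ) ≤ a := by exact_mod_cast ha
  have hmem := fun n => (gaussOrbit_irrational_mem hirr hθ n).2
  have hbdd : BddAbove (Set.range (gaussOrbit θ)) :=
    ⟨1, by rintro _ ⟨n, rfl⟩; exact (hmem n).2.le⟩
  set R := ⨆ n, gaussOrbit θ n with hR
  have hle : ∀ n, gaussOrbit θ n ≤ R := le_ciSup hbdd
  have hR0 : 0 < R := (hmem 0).1.trans_le (hle 0)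
  have hbound : ∀ n, gaussOrbit θ n ≤ (2 * a + R) / (2 * a + R + 1) := by
    intro n
    have e₁ := gaussOrbit_mul hirr hθ n
    have e₂ := gaussOrbit_mul hirr hθ (n + 1)
    have hA : (1 : ℝ) ≤ partQuot θ n := by exact_mod_cast one_le_partQuot hirr hθ n
    have hA' : (partQuot θ (n + 1) : ℝ) ≤ 2 * a := by exact_mod_cast hB (n + 1)
    have p₀ := hmem n
    have p₁ := hmem (n + 1)
    have h₁ : gaussOrbit θ n * (1 + gaussOrbit θ (n + 1)) ≤ 1 := by nlinarith [p₀.1]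
    have h₂ : 1 ≤ gaussOrbit θ (n + 1) * (2 * a + R) := by nlinarith [p₁.1, hle (n + 2)]
    rw [le_div_iff₀ (by positivity)]
    have h₃ : gaussOrbit θ n * (1 + gaussOrbit θ (n + 1)) * (2 * a + R) ≤ 1 * (2 * a + R) :=
      mul_le_mul_of_nonneg_right h₁ (by positivity)
    nlinarith [mul_le_mul_of_nonneg_left h₂ p₀.1.le]
  have hR' : R ≤ (2 * a + R) / (2 * a + R + 1) := ciSup_le hbound
  rw [le_div_iff₀ (by positivity)] at hR'
  refine (hle n).trans ?_
  rw [evenMax, le_sub_iff_add_le]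
  exact Real.le_sqrt_of_sq_le (by nlinarith)

lemma convDen_ratio_bounds {θ : ℝ} (ha : 1 ≤ a) (hirr : Irrational θ)
    (hθ : θ ∈ Set.Ioo (0 : ℝ) 1) (hB : ∀ n, partQuot θ n ≤ 2 * a) (n : ℕ) :
    convDen θ n ≤ evenMax a * convDen θ (n + 1) + 1 ∧
      evenMax a / (2 * a) * convDen θ (n + 1) ≤ convDen θ n + 1 := by
  have ha' : (1 : ℝ) ≤ a := by exact_mod_cast ha
  have ht := evenMax_mem ha
  obtain ⟨r₁, r₂⟩ := evenMax_relations ha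
  have hu0 : 0 < evenMax a / (2 * a) := div_pos ht.1 (by positivity)
  have hu1 : evenMax a / (2 * a) ≤ 1 := by
    rw [div_le_one (by positivity)]
    linarith [ht.2]
  set t := evenMax a
  set u := t / (2 * a)
  induction n with
  | zero =>
    simp only [convDen, Nat.cast_zero, Nat.cast_one, zero_add, mul_one]
    exact ⟨by linarith [ht.1], hu1⟩
  | succ n ih =>
    have hA : (1 : ℝ) ≤ partQuot θ n := by exact_mod_cast one_le_partQuot hirr hθ n
    have hA' : (partQuot θ n : ℝ) ≤ 2 * a := by exact_mod_cast hB n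
    have hq : (0 : ℝ) ≤ convDen θ (n + 1) := Nat.cast_nonneg _
    rw [convDen]
    push_cast
    set q := (convDen θ (n + 1) : ℝ)
    set q' := (convDen θ n : ℝ)
    constructor
    · have h : (1 + u) * q - 1 ≤ partQuot θ n * q + q' := by nlinarith [ih.2]
      have h' := mul_le_mul_of_nonneg_left h ht.1.le
      have : t * ((1 + u) * q - 1) = q - t := by linear_combination q * r₁
      linarith [ht.2]
    · have h : partQuot θ n * q + q' ≤ (2 * a + t) * q + 1 := by nlinarith [ih.1]
      have h' := mul_le_mul_of_nonneg_left h hu0.le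
      have : u * ((2 * a + t) * q + 1) = q + u := by linear_combination q * r₂
      linarith

/-- The objective `(x + 1)(y + 1) / (x + y)` is at most its value at `x = y = r`. -/
lemma mul_le_of_add_le {x y r : ℝ} (hx : 0 ≤ x) (hy : 1 ≤ y) (hr : 1 ≤ r) (hxy : x + y ≤ 2 * r) :
    (x + 1) * (y + 1) * (2 * r) ≤ (r + 1) ^ 2 * (x + y) := by
  rcases le_or_gt x 1 with h | h
  · have h₁ : x * y + 1 ≤ x + y := by nlinarith
    have h₂ : (x + 1) * (y + 1) ≤ 2 * (x + y) := by linarith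
    have h₃ : 4 * r ≤ (r + 1) ^ 2 := by nlinarith [sq_nonneg (r - 1)]
    nlinarith
  · have h₁ : 4 * (x * y) ≤ (x + y) ^ 2 := by nlinarith [sq_nonneg (x - y)]
    have h₂ : 0 ≤ (2 * r - (x + y)) * (r * (x + y) - 2) :=
      mul_nonneg (by linarith) (by nlinarith)
    nlinarith

lemma mul_maxGap_le {θ : ℝ} (ha : 1 ≤ a) (hθ : θ ∈ SB (2 * a)) {N : ℕ} (hN : 1 ≤ N) :
    N * maxGap θ N ≤ (evenRoot a + 1) ^ 2 / (2 * evenRoot a) := by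
  obtain ⟨hirr, hmem, hpq⟩ := hθ
  have hB := (partQuotBounded_iff hirr hmem _).1 hpq
  obtain ⟨n, m, hm, hP, hQ, hN'⟩ := exists_convDen_bracket hirr hmem hN
  have hH := maxGap_le_convErr hirr hmem hm hP hQ
  have hD := convErr_pos hirr hmem (n + 1)
  have hdet := convDen_mul_convErr hirr hmem n
  have hα := convErr_eq_mul hirr hmem n
  have hx := gaussOrbit_le_evenMax ha hirr hmem hB (n + 1)
  have hx0 := (gaussOrbit_irrational_mem hirr hmem (n + 1)).2.1
  have hβ := (convDen_ratio_bounds ha hirr hmem hB n).1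
  have hP0 : (0 : ℝ) < convDen θ (n + 1) := by exact_mod_cast convDen_pos hirr hmem n
  have hq0 : (0 : ℝ) ≤ convDen θ n := Nat.cast_nonneg _
  have hm1 : (m : ℝ) + 1 ≤ partQuot θ n := by exact_mod_cast hm
  have hA : (partQuot θ n : ℝ) ≤ 2 * a := by exact_mod_cast hB n
  have hN1 : (N : ℝ) + 1 ≤ convDen θ n + (m + 1) * convDen θ (n + 1) := by exact_mod_cast hN'
  have hr := one_le_evenRoot ha
  have ht := (evenMax_mem ha).1
  have htr : evenMax a + a = evenRoot a := by rw [evenMax]; ring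
  rw [hα] at hH hdet
  set D := convErr θ (n + 1)
  set P := (convDen θ (n + 1) : ℝ)
  set q := (convDen θ n : ℝ)
  set α := (partQuot θ n : ℝ) + gaussOrbit θ (n + 1)
  obtain ⟨β, hβ0, hβt, hβq, hβN⟩ :
      ∃ β : ℝ, 0 ≤ β ∧ β ≤ evenMax a ∧ P * β ≤ q ∧ q - 1 ≤ P * β := by
    refine ⟨min (q / P) (evenMax a), le_min (by positivity) ht.le, min_le_right _ _, ?_, ?_⟩
    · calc P * min (q / P) (evenMax a) ≤ P * (q / P) :=
            mul_le_mul_of_nonneg_left (min_le_left _ _) hP0.le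
        _ = q := by field_simp
    · rw [mul_min_of_nonneg _ _ hP0.le, mul_div_cancel₀ _ hP0.ne']
      exact le_min (by linarith) (by linarith)
  have hm0 : (0 : ℝ) ≤ m := Nat.cast_nonneg _
  have hy1 : 1 ≤ α - m := by simp only [α]; linarith
  have hopt := mul_le_of_add_le (x := β + m) (y := α - m) (r := evenRoot a) (by positivity) hy1 hr
    (by simp only [α]; linarith)
  rw [show β + m + (α - m) = α + β by ring] at hopt
  have hPD : P * D * (α + β) ≤ 1 := by nlinarith
  have hNP : (N : ℝ) ≤ P * (β + m + 1) := by nlinarith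
  have hH' : maxGap θ N ≤ (α - m + 1) * D := by linarith
  rw [le_div_iff₀ (by positivity)]
  calc N * maxGap θ N * (2 * evenRoot a)
      ≤ P * (β + m + 1) * ((α - m + 1) * D) * (2 * evenRoot a) := by
        refine mul_le_mul_of_nonneg_right ?_ (by positivity)
        exact (mul_le_mul_of_nonneg_left hH' (Nat.cast_nonneg _)).trans
          (mul_le_mul_of_nonneg_right hNP (mul_nonneg (by linarith) hD.le))
    _ = P * D * ((β + m + 1) * (α - m + 1) * (2 * evenRoot a)) := by ring
    _ ≤ P * D * ((evenRoot a + 1) ^ 2 * (α + β)) :=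
        mul_le_mul_of_nonneg_left hopt (by positivity)
    _ = (evenRoot a + 1) ^ 2 * (P * D * (α + β)) := by ring
    _ ≤ (evenRoot a + 1) ^ 2 * 1 := mul_le_mul_of_nonneg_left hPD (by positivity)
    _ = (evenRoot a + 1) ^ 2 := mul_one _

lemma gaussOrbit_evenMax (ha : 1 ≤ a) (n : ℕ) :
    gaussOrbit (evenMax a) (2 * n) = evenMax a ∧
      gaussOrbit (evenMax a) (2 * n + 1) = evenMax a / (2 * a) := by
  have ha' : (1 : ℝ) ≤ a := by exact_mod_cast ha
  have ht := evenMax_mem ha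
  obtain ⟨r₁, r₂⟩ := evenMax_relations ha
  have hu0 : 0 < evenMax a / (2 * a) := div_pos ht.1 (by positivity)
  have hu1 : evenMax a / (2 * a) < 1 := by
    rw [div_lt_one (by positivity)]
    linarith [ht.2]
  have i₁ : (evenMax a)⁻¹ = 1 + evenMax a / (2 * a) := inv_eq_of_mul_eq_one_right r₁
  have i₂ : (evenMax a / (2 * a))⁻¹ = 2 * a + evenMax a :=
    inv_eq_of_mul_eq_one_right r₂
  have s₁ : Int.fract (evenMax a)⁻¹ = evenMax a / (2 * a) := by
    rw [i₁, Int.fract_eq_iff]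
    exact ⟨hu0.le, hu1, 1, by push_cast; ring⟩
  have s₂ : Int.fract (evenMax a / (2 * a))⁻¹ = evenMax a := by
    rw [i₂, Int.fract_eq_iff]
    exact ⟨ht.1.le, ht.2, 2 * a, by push_cast; ring⟩
  induction n with
  | zero => exact ⟨rfl, s₁⟩
  | succ n ih =>
    have h : gaussOrbit (evenMax a) (2 * (n + 1)) = evenMax a := by
      rw [show 2 * (n + 1) = 2 * n + 1 + 1 by ring, gaussOrbit, ih.2, s₂]
    exact ⟨h, by rw [gaussOrbit, h, s₁]⟩

lemma partQuot_evenMax (ha : 1 ≤ a) (n : ℕ) :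
    partQuot (evenMax a) (2 * n) = 1 ∧ partQuot (evenMax a) (2 * n + 1) = 2 * a := by
  have hirr := irrational_evenMax ha
  have ht := evenMax_mem ha
  obtain ⟨r₁, r₂⟩ := evenMax_relations ha
  have g := gaussOrbit_evenMax ha n
  have g' := (gaussOrbit_evenMax ha (n + 1)).1
  have e₁ := gaussOrbit_mul hirr ht (2 * n)
  have e₂ := gaussOrbit_mul hirr ht (2 * n + 1)
  rw [show 2 * n + 1 + 1 = 2 * (n + 1) by ring, g', g.2] at e₂
  rw [g.1, g.2] at e₁
  have hu0 : evenMax a / (2 * a) ≠ 0 := by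
    intro h
    rw [h, zero_mul] at r₂
    exact zero_ne_one r₂
  constructor
  · have := mul_left_cancel₀ ht.1.ne' (e₁.trans r₁.symm)
    have : (partQuot (evenMax a) (2 * n) : ℝ) = 1 := by linarith
    exact_mod_cast this
  · have := mul_left_cancel₀ hu0 (e₂.trans r₂.symm)
    have : (partQuot (evenMax a) (2 * n + 1) : ℝ) = 2 * a := by linarith
    exact_mod_cast this

lemma partQuot_evenMax_le (ha : 1 ≤ a) (n : ℕ) : partQuot (evenMax a) n ≤ 2 * a := by
  rcases Nat.even_or_odd' n with ⟨k, rfl | rfl⟩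
  · rw [(partQuot_evenMax ha k).1]
    omega
  · exact (partQuot_evenMax ha k).2.le

lemma evenMax_mem_SB (ha : 1 ≤ a) : evenMax a ∈ SB (2 * a) :=
  ⟨irrational_evenMax ha, evenMax_mem ha,
    (partQuotBounded_iff (irrational_evenMax ha) (evenMax_mem ha) _).2 (partQuot_evenMax_le ha)⟩

lemma convDen_evenMax_ratio (ha : 1 ≤ a) (n : ℕ) :
    evenMax a * convDen (evenMax a) (2 * n + 2) ≤ convDen (evenMax a) (2 * n + 1) + 1 := by
  have ht := evenMax_mem ha
  obtain ⟨r₁, r₂⟩ := evenMax_relations ha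
  have ha' : (1 : ℝ) ≤ a := by exact_mod_cast ha
  have hu0 : 0 < evenMax a / (2 * a) := div_pos ht.1 (by positivity)
  have hu1 : evenMax a / (2 * a) ≤ 1 := by
    rw [div_le_one (by positivity)]
    linarith [ht.2]
  induction n with
  | zero =>
    simp only [convDen, (partQuot_evenMax ha 0).1]
    push_cast
    linarith [ht.2]
  | succ n ih =>
    rw [show 2 * (n + 1) = 2 * n + 2 by ring, convDen.eq_3 _ (2 * n + 2),
      show 2 * n + 2 = 2 * (n + 1) by ring, (partQuot_evenMax ha (n + 1)).1,
      show 2 * (n + 1) + 1 = 2 * n + 1 + 2 by ring, convDen.eq_3 _ (2 * n + 1),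
      (partQuot_evenMax ha n).2, show 2 * (n + 1) = 2 * n + 1 + 1 by ring]
    rw [show 2 * n + 2 = 2 * n + 1 + 1 by ring] at ih
    push_cast
    set t := evenMax a
    set u := t / (2 * a)
    set q := (convDen t (2 * n + 1 + 1) : ℝ)
    set q' := (convDen t (2 * n + 1) : ℝ)
    have h : (2 * a + t) * q - 1 ≤ 2 * a * q + q' := by linarith
    have h' := mul_le_mul_of_nonneg_left h hu0.le
    have e : u * ((2 * a + t) * q - 1) = q - u := by linear_combination q * r₂
    have h'' : t * q ≤ t * (u * (2 * a * q + q') + 1) :=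
      mul_le_mul_of_nonneg_left (by linarith) ht.1.le
    have e' : t * (u * (2 * a * q + q') + 1) + t * (2 * a * q + q') =
        2 * a * q + q' + t := by linear_combination (2 * a * q + q') * r₁
    linarith [ht.2]

/-- Values of `N · H(θ, N)` along the even convergents of the extremal number. -/
lemma exists_le_mul_maxGap (ha : 1 ≤ a) (n : ℕ) :
    ∃ q N : ℕ, n ≤ q ∧ 1 ≤ N ∧
      ((evenRoot a + 1) * q - 3) * (evenRoot a + 1) ≤
        N * maxGap (evenMax a) N * (2 * evenRoot a * q + 1) := by
  have hirr := irrational_evenMax ha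
  have ht := evenMax_mem ha
  have hratio := convDen_evenMax_ratio ha (n + 1)
  have hratio' := (convDen_ratio_bounds ha hirr ht (partQuot_evenMax_le ha) (2 * (n + 1) + 1)).1
  have hle := le_convDen hirr ht (2 * (n + 1) + 1)
  have hpos := convDen_pos hirr ht (2 * (n + 1))
  obtain ⟨k, hk⟩ : ∃ k, k = 2 * (n + 1) + 1 := ⟨_, rfl⟩
  have hodd : Odd k := ⟨_, hk⟩
  have hA : partQuot (evenMax a) k = 2 * a := by rw [hk, (partQuot_evenMax ha (n + 1)).2]
  have hx : gaussOrbit (evenMax a) (k + 1) = evenMax a := by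
    rw [hk, show 2 * (n + 1) + 1 + 1 = 2 * (n + 2) by ring, (gaussOrbit_evenMax ha (n + 2)).1]
  rw [show 2 * (n + 1) + 2 = 2 * (n + 1) + 1 + 1 by ring] at hratio
  rw [← hk] at hratio hratio' hle hpos
  have hD := convErr_pos hirr ht (k + 1)
  have hdet := convDen_mul_convErr hirr ht k
  have hα := convErr_eq_mul hirr ht k
  rw [hA, hx] at hα
  have hunim := convDen_det (evenMax a) k
  rw [hodd.neg_one_pow] at hunim
  have e₁ : convErr (evenMax a) (k + 1) =
      convNum (evenMax a) (k + 1) - convDen (evenMax a) (k + 1) * evenMax a := by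
    rw [convErr_eq hirr ht, hodd.add_one.add_one.neg_one_pow]
    ring
  have e₂ : convErr (evenMax a) k - a * convErr (evenMax a) (k + 1) =
      ((convDen (evenMax a) k + a * convDen (evenMax a) (k + 1) : ℕ) : ℝ) * evenMax a -
      ((convNum (evenMax a) k + a * convNum (evenMax a) (k + 1) : ℤ) : ℝ) := by
    rw [e₁, convErr_eq hirr ht k, hodd.add_one.neg_one_pow]
    push_cast
    ring
  have htr : evenMax a = evenRoot a - a := rfl
  have hr := one_le_evenRoot ha
  have e₃ : convErr (evenMax a) k - a * convErr (evenMax a) (k + 1) =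
      evenRoot a * convErr (evenMax a) (k + 1) := by
    rw [hα, htr]
    push_cast
    ring
  obtain ⟨P, hP⟩ : ∃ P, convDen (evenMax a) k + a * convDen (evenMax a) (k + 1) = P + 1 :=
    Nat.exists_eq_succ_of_ne_zero (by omega)
  obtain ⟨Q, hQ⟩ : ∃ Q, convDen (evenMax a) (k + 1) = Q + 1 :=
    Nat.exists_eq_succ_of_ne_zero (by omega)
  have hgap := add_le_maxGap (θ := evenMax a) (P := P) (Q := Q)
    (p := convNum (evenMax a) k + a * convNum (evenMax a) (k + 1))
    (p' := convNum (evenMax a) (k + 1))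
    (by rw [← hP, ← e₂, e₃]; positivity) (by rw [← hQ, ← e₁]; exact hD)
    (by rw [← hP, ← hQ]; push_cast; linear_combination -hunim)
  rw [← hP, ← hQ, ← e₂, ← e₁, e₃] at hgap
  refine ⟨convDen (evenMax a) (k + 1), P + Q, by omega, by omega, ?_⟩
  have hNcast : ((P + Q : ℕ) : ℝ) + 2 =
      convDen (evenMax a) k + (a + 1) * convDen (evenMax a) (k + 1) := by
    have : P + Q + 2 = convDen (evenMax a) k + (a + 1) * convDen (evenMax a) (k + 1) := by
      rw [add_mul, one_mul, ← add_assoc, hP, hQ]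
      ring
    exact_mod_cast this
  have hN0 : (0 : ℝ) ≤ ((P + Q : ℕ) : ℝ) := Nat.cast_nonneg _
  have hq0 : (0 : ℝ) ≤ convDen (evenMax a) (k + 1) := Nat.cast_nonneg _
  rw [hα] at hdet
  push_cast at hdet
  generalize ((P + Q : ℕ) : ℝ) = N at *
  generalize maxGap (evenMax a) (P + Q) = H at *
  generalize (convDen (evenMax a) (k + 1) : ℝ) = q at *
  generalize (convDen (evenMax a) k : ℝ) = q' at *
  generalize convErr (evenMax a) (k + 1) = D at *
  rw [htr] at hdet hratio hratio'
  have hDq : 1 ≤ D * (2 * evenRoot a * q + 1) := by nlinarith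
  have hNq : (evenRoot a + 1) * q - 3 ≤ N := by linarith
  have hs : 0 ≤ 2 * evenRoot a * q + 1 := by positivity
  calc ((evenRoot a + 1) * q - 3) * (evenRoot a + 1)
      ≤ N * (evenRoot a + 1) := mul_le_mul_of_nonneg_right hNq (by linarith)
    _ ≤ N * (evenRoot a + 1) * (D * (2 * evenRoot a * q + 1)) :=
        le_mul_of_one_le_right (by positivity) hDq
    _ = N * ((evenRoot a * D + D) * (2 * evenRoot a * q + 1)) := by ring
    _ ≤ N * (H * (2 * evenRoot a * q + 1)) := by gcongr
    _ = N * H * (2 * evenRoot a * q + 1) := by ring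

end Extremal

/-- **Theorem 4, even case.**  For `B = 2a` with `a ≥ 1`,
`f(B) = 1 + (a+1)² / (2√(a²+2a))`. -/
theorem badF_even (a : ℕ) (ha : 1 ≤ a) :
    badF (2 * a) = 1 + ((a : ℝ) + 1) ^ 2 / (2 * Real.sqrt ((a : ℝ) ^ 2 + 2 * a)) := by
  have hr := one_le_evenRoot ha
  have hval : 1 + ((a : ℝ) + 1) ^ 2 / (2 * Real.sqrt ((a : ℝ) ^ 2 + 2 * a)) =
      (evenRoot a + 1) ^ 2 / (2 * evenRoot a) := by
    rw [← evenRoot]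
    field_simp
    linear_combination -evenRoot_sq a
  have hub : ∀ x ∈ {x : ℝ | ∃ θ ∈ SB (2 * a), ∃ N : ℕ, 1 ≤ N ∧ x = (N : ℝ) * maxGap θ N},
      x ≤ (evenRoot a + 1) ^ 2 / (2 * evenRoot a) := by
    rintro _ ⟨θ, hθ, N, hN, rfl⟩
    exact mul_maxGap_le ha hθ hN
  rw [hval]
  refine le_antisymm (Real.sSup_le hub (by positivity)) ?_
  rw [div_le_iff₀ (by positivity)]
  by_contra! h
  obtain ⟨n, hn⟩ := exists_nat_gt ((badF (2 * a) + 3 * (evenRoot a + 1)) /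
    ((evenRoot a + 1) ^ 2 - badF (2 * a) * (2 * evenRoot a)))
  rw [div_lt_iff₀ (by linarith)] at hn
  obtain ⟨q, N, hq, hN, hle⟩ := exists_le_mul_maxGap ha n
  have hsup : (N : ℝ) * maxGap (evenMax a) N ≤ badF (2 * a) :=
    le_csSup ⟨_, hub⟩ ⟨_, evenMax_mem_SB ha, N, hN, rfl⟩
  have hq' : (n : ℝ) ≤ q := by exact_mod_cast hq
  have h₁ := hle.trans (mul_le_mul_of_nonneg_right hsup (by positivity))
  have h₂ := mul_le_mul_of_nonneg_right hq' (sub_nonneg.2 h.le)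
  linarith
end
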